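/- arXiv:2403.05412 — 3 statements merged into one kernel-verified Lean document; each statement's English description precedes it below -/
import Mathlib

section
/- Let d ≥ 1 and let H : ℝ^d × ℝ^d → ℝ be C² with H(x,·) convex for every x and with wᵀ ∂_{pp}H(x,p) w > 0 for all (x,p) ∈ ℝ^d × ℝ^d and all unit vectors w ∈ ℝ^d. Assume (wᵀ Re ∂_{xp}H(x,p) w)² − (wᵀ ∂_{pp}H(x,p) w)(wᵀ ∂_{xx}H(x,p) w) ≥ 0 for all (x,p) and all w ∈ ℝ^d. Let α ∈ ℝ satisfy r₋(x,p,w) ≤ α ≤ r₊(x,p,w) for all (x,p) ∈ ℝ^d × ℝ^d and all unit vectors w ∈ ℝ^d. Then the transformed Hamiltonian H_α(x,p) := H(x, p − α x) satisfies: H_α(·,p) is concave on ℝ^d for every p, and H_α(x,·) is convex on ℝ^d for every x. -/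
open Set

/-- `w ↦ wᵀ ∂_{xx}H(x,p) w`: the quadratic form of the second-derivative block of `H`
in the first (state) variable, expressed via the second iterated Fréchet derivative. -/
noncomputable def Qxx (d : ℕ)
    (H : EuclideanSpace ℝ (Fin d) × EuclideanSpace ℝ (Fin d) → ℝ)
    (x p w : EuclideanSpace ℝ (Fin d)) : ℝ :=
  iteratedFDeriv ℝ 2 H (x, p) ![(w, 0), (w, 0)]

/-- `w ↦ wᵀ ∂_{pp}H(x,p) w`: the quadratic form of the second-derivative block of `H`
in the second (momentum) variable. -/
noncomputable def Qpp (d : ℕ)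
    (H : EuclideanSpace ℝ (Fin d) × EuclideanSpace ℝ (Fin d) → ℝ)
    (x p w : EuclideanSpace ℝ (Fin d)) : ℝ :=
  iteratedFDeriv ℝ 2 H (x, p) ![(0, w), (0, w)]

/-- `w ↦ wᵀ (Re ∂_{xp}H(x,p)) w`: the quadratic form of the symmetrized mixed
second-derivative block of `H`, where `Re A = (A + Aᵀ)/2`. -/
noncomputable def Qxp (d : ℕ)
    (H : EuclideanSpace ℝ (Fin d) × EuclideanSpace ℝ (Fin d) → ℝ)
    (x p w : EuclideanSpace ℝ (Fin d)) : ℝ :=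
  (1 / 2) * (iteratedFDeriv ℝ 2 H (x, p) ![(w, 0), (0, w)] +
    iteratedFDeriv ℝ 2 H (x, p) ![(0, w), (w, 0)])

/-- The root `r₊(x,p,w)` of the quadratic polynomial
`α ↦ wᵀ∂_{xx}H w - 2α wᵀ(Re ∂_{xp}H) w + α² wᵀ∂_{pp}H w`. -/
noncomputable def rplus (d : ℕ)
    (H : EuclideanSpace ℝ (Fin d) × EuclideanSpace ℝ (Fin d) → ℝ)
    (x p w : EuclideanSpace ℝ (Fin d)) : ℝ :=
  (Qxp d H x p w +
      Real.sqrt ((Qxp d H x p w) ^ 2 - Qpp d H x p w * Qxx d H x p w)) /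
    Qpp d H x p w

/-- The root `r₋(x,p,w)` of the quadratic polynomial
`α ↦ wᵀ∂_{xx}H w - 2α wᵀ(Re ∂_{xp}H) w + α² wᵀ∂_{pp}H w`. -/
noncomputable def rminus (d : ℕ)
    (H : EuclideanSpace ℝ (Fin d) × EuclideanSpace ℝ (Fin d) → ℝ)
    (x p w : EuclideanSpace ℝ (Fin d)) : ℝ :=
  (Qxp d H x p w -
      Real.sqrt ((Qxp d H x p w) ^ 2 - Qpp d H x p w * Qxx d H x p w)) /
    Qpp d H x p w

theorem concaveOn_line_of_iteratedFDeriv_two_nonpos {E : Type*} [NormedAddCommGroup E]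
    [NormedSpace ℝ E] {f : E → ℝ} (hf : ContDiff ℝ 2 f) (x v : E)
    (h : ∀ t : ℝ, iteratedFDeriv ℝ 2 f (x + t • v) ![v, v] ≤ 0) :
    ConcaveOn ℝ Set.univ (fun t : ℝ => f (x + t • v)) := by
  have hline : ∀ t : ℝ, HasDerivAt (fun t : ℝ => x + t • v) v t := fun t => by
    simpa using ((hasDerivAt_id t).smul_const v).const_add x
  have h1 : ∀ t : ℝ, HasDerivAt (fun t : ℝ => f (x + t • v)) (fderiv ℝ f (x + t • v) v) t :=
    fun t => ((hf.differentiable (by norm_num)) _).hasFDerivAt.comp_hasDerivAt t (hline t)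
  have hf' : ContDiff ℝ 1 (fderiv ℝ f) := hf.fderiv_right (by norm_num)
  have h2 : ∀ t : ℝ, HasDerivAt (fun t : ℝ => fderiv ℝ f (x + t • v) v)
      (fderiv ℝ (fderiv ℝ f) (x + t • v) v v) t := fun t => by
    have := ((hf'.differentiable (by norm_num)) _).hasFDerivAt.comp_hasDerivAt t (hline t)
    simpa using this.clm_apply (hasDerivAt_const t v)
  refine concaveOn_of_hasDerivWithinAt2_nonpos convex_univ
    (fun t _ => (h1 t).continuousAt.continuousWithinAt)
    (fun t _ => (h1 t).hasDerivWithinAt) (fun t _ => (h2 t).hasDerivWithinAt) fun t _ => ?_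
  simpa [iteratedFDeriv_two_apply] using h t

theorem concaveOn_univ_of_concaveOn_lines {E : Type*} [AddCommGroup E] [Module ℝ E] {f : E → ℝ}
    (h : ∀ x v : E, ConcaveOn ℝ Set.univ (fun t : ℝ => f (x + t • v))) :
    ConcaveOn ℝ Set.univ f := by
  refine ⟨convex_univ, fun x _ y _ a b ha hb hab => ?_⟩
  have key := (h x (y - x)).2 (mem_univ 0) (mem_univ 1) ha hb hab
  have hxy : x + b • (y - x) = a • x + b • y := by
    rw [← eq_sub_iff_add_eq] at hab
    subst hab
    module
  simpa [hxy] using key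

/-- A point between the two roots of a quadratic with positive leading coefficient and
nonnegative discriminant makes the quadratic nonpositive. -/
theorem quadratic_nonpos_of_between_roots {a b c r : ℝ} (ha : 0 < a) (hd : 0 ≤ b ^ 2 - a * c)
    (h1 : (b - √(b ^ 2 - a * c)) / a ≤ r) (h2 : r ≤ (b + √(b ^ 2 - a * c)) / a) :
    c - 2 * r * b + r ^ 2 * a ≤ 0 := by
  rw [div_le_iff₀ ha] at h1
  rw [le_div_iff₀ ha] at h2
  have hsq : (r * a - b) ^ 2 ≤ b ^ 2 - a * c := by
    rw [← Real.sq_sqrt hd]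
    exact sq_le_sq' (by linarith) (by linarith)
  exact nonpos_of_mul_nonpos_right (by linarith : a * (c - 2 * r * b + r ^ 2 * a) ≤ 0) ha

theorem iteratedFDeriv_two_shear (d : ℕ)
    (H : EuclideanSpace ℝ (Fin d) × EuclideanSpace ℝ (Fin d) → ℝ) (α c : ℝ)
    (x p w : EuclideanSpace ℝ (Fin d)) :
    iteratedFDeriv ℝ 2 H (x, p) ![c • (w, -(α • w)), c • (w, -(α • w))] =
      c ^ 2 * (Qxx d H x p w - 2 * α * Qxp d H x p w + α ^ 2 * Qpp d H x p w) := by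
  have hw : (w, -(α • w)) = ((w, 0) : EuclideanSpace ℝ (Fin d) × EuclideanSpace ℝ (Fin d)) -
      α • (0, w) := by simp
  simp only [hw, Qxx, Qxp, Qpp, iteratedFDeriv_two_apply, Matrix.cons_val_zero,
    Matrix.cons_val_one, map_sub, map_smul, sub_apply,
    smul_apply, smul_eq_mul]
  ring

/-- (Lemma 3.2 of the paper.) If `H` is `C²`, convex and nondegenerate in
`p`, the discriminant condition holds, and `α` lies between `r₋` and `r₊` everywhere, then
`H_α(x,p) = H(x, p - αx)` is concave in `x` and convex in `p`. -/
theorem transformed_hamiltonian_concave_convex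
    (d : ℕ) (hd : 1 ≤ d)
    (H : EuclideanSpace ℝ (Fin d) × EuclideanSpace ℝ (Fin d) → ℝ)
    (hHsmooth : ContDiff ℝ 2 H)
    (hHconvp : ∀ x : EuclideanSpace ℝ (Fin d),
      ConvexOn ℝ Set.univ (fun p : EuclideanSpace ℝ (Fin d) => H (x, p)))
    (hQpp : ∀ (x p w : EuclideanSpace ℝ (Fin d)), ‖w‖ = 1 → 0 < Qpp d H x p w)
    (hdisc : ∀ x p w : EuclideanSpace ℝ (Fin d),
      0 ≤ (Qxp d H x p w) ^ 2 - Qpp d H x p w * Qxx d H x p w)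
    (α : ℝ)
    (hα : ∀ (x p w : EuclideanSpace ℝ (Fin d)), ‖w‖ = 1 →
      rminus d H x p w ≤ α ∧ α ≤ rplus d H x p w) :
    (∀ p : EuclideanSpace ℝ (Fin d),
      ConcaveOn ℝ Set.univ (fun x : EuclideanSpace ℝ (Fin d) => H (x, p - α • x))) ∧
    (∀ x : EuclideanSpace ℝ (Fin d),
      ConvexOn ℝ Set.univ (fun p : EuclideanSpace ℝ (Fin d) => H (x, p - α • x))) := by
  refine ⟨fun p => ?_, fun x => ?_⟩
  · refine concaveOn_univ_of_concaveOn_lines fun x v => ?_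
    have hline : ∀ t : ℝ, (x + t • v, p - α • (x + t • v)) =
        (x, p - α • x) + t • (v, -(α • v)) := fun t => by
      ext1
      · rfl
      · simp only [Prod.snd_add, Prod.smul_snd]
        module
    simp only [hline]
    refine concaveOn_line_of_iteratedFDeriv_two_nonpos hHsmooth _ _ fun t => ?_
    rw [← hline]
    obtain rfl | hv := eq_or_ne v 0
    · simp [iteratedFDeriv_two_apply, Prod.mk_zero_zero]
    · have hw : ‖(‖v‖⁻¹ • v)‖ = 1 := norm_smul_inv_norm (𝕜 := ℝ) hv
      have hvw : (v, -(α • v)) = ‖v‖ • (‖v‖⁻¹ • v, -(α • (‖v‖⁻¹ • v))) := by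
        have hn : ‖v‖ ≠ 0 := norm_ne_zero_iff.mpr hv
        rw [Prod.smul_mk, smul_neg, smul_comm ‖v‖ α, smul_inv_smul₀ hn]
      rw [hvw, iteratedFDeriv_two_shear]
      exact mul_nonpos_of_nonneg_of_nonpos (sq_nonneg _)
        (quadratic_nonpos_of_between_roots (hQpp _ _ _ hw) (hdisc _ _ _)
          (hα _ _ _ hw).1 (hα _ _ _ hw).2)
  · simpa [Function.comp_def, sub_eq_add_neg] using (hHconvp x).translate_left (-(α • x))
end

section
/- Let d ≥ 1. Let H : ℝ^d × ℝ^d → ℝ be C² with H(x,·) convex for every x, and suppose there are constants 0 < μ ≤ M such that μ ≤ wᵀ ∂_{pp}H(x,p) w ≤ M for all (x,p) and all unit vectors w. Let G : ℝ^d → ℝ be C². Suppose λ₀, λ_H, λ_G ∈ ℝ satisfy λ₀ ≤ wᵀ Re ∂_{xp}H(x,p) w, wᵀ ∂_{xx}H(x,p) w ≤ λ_H, and λ_G ≤ wᵀ ∂_{xx}G(x) w, for all x, p and all unit vectors w. If λ₀² ≥ M λ_H, λ₀ + √(λ₀² − M λ_H) + M λ_G ≥ 0, and moreover either λ_H ≤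 0 or λ₀ ≥ 0, then there exists α ∈ ℝ such that, for H_α(x,p) := H(x, p − αx) and G_α(x) := G(x) + (α/2)|x|², the function H_α(·,p) is concave on ℝ^d for every p, the function H_α(x,·) is convex on ℝ^d for every x, and G_α is convex on ℝ^d. -/
open Set

/-- `w ↦ wᵀ ∂_{xx}G(x) w`: the Hessian quadratic form of `G`. -/
noncomputable def QG (d : ℕ) (G : EuclideanSpace ℝ (Fin d) → ℝ)
    (x w : EuclideanSpace ℝ (Fin d)) : ℝ :=
  iteratedFDeriv ℝ 2 G x ![w, w]

/-- A function is convex as soon as its restriction to every line is convex. -/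
theorem convexOn_univ_of_forall_line {E : Type*} [AddCommGroup E] [Module ℝ E] {f : E → ℝ}
    (h : ∀ x v : E, ConvexOn ℝ univ (fun t : ℝ => f (x + t • v))) :
    ConvexOn ℝ univ f := by
  refine ⟨convex_univ, fun x _ y _ a b ha hb hab => ?_⟩
  have key := (h x (y - x)).2 (mem_univ 0) (mem_univ 1) ha hb hab
  obtain rfl : a = 1 - b := by linarith
  have hpt : x + b • (y - x) = (1 - b) • x + b • y := by module
  simpa [hpt] using key

/-- A function on `ℝ` with a nonnegative second derivative is convex. -/
theorem convexOn_univ_of_hasDerivAt2_nonneg {f f' f'' : ℝ → ℝ}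
    (hf : ∀ t, HasDerivAt f (f' t) t) (hf' : ∀ t, HasDerivAt f' (f'' t) t)
    (hf'' : ∀ t, 0 ≤ f'' t) : ConvexOn ℝ univ f :=
  convexOn_of_hasDerivWithinAt2_nonneg convex_univ
    (fun t _ => (hf t).continuousAt.continuousWithinAt)
    (fun t _ => (hf t).hasDerivWithinAt) (fun t _ => (hf' t).hasDerivWithinAt)
    (fun t _ => hf'' t)

section Line

variable {E : Type*} [NormedAddCommGroup E] [NormedSpace ℝ E] {F : E → ℝ}

theorem hasDerivAt_add_smul (y v : E) (t : ℝ) :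
    HasDerivAt (fun s : ℝ => y + s • v) v t := by
  simpa using ((hasDerivAt_id t).smul_const v).const_add y

theorem ContDiff.hasDerivAt_line (hF : ContDiff ℝ 2 F) (y v : E) (t : ℝ) :
    HasDerivAt (fun s : ℝ => F (y + s • v)) (fderiv ℝ F (y + t • v) v) t :=
  ((hF.differentiable two_ne_zero) (y + t • v)).hasFDerivAt.comp_hasDerivAt t
    (hasDerivAt_add_smul y v t)

theorem ContDiff.hasDerivAt_fderiv_line (hF : ContDiff ℝ 2 F) (y v : E) (t : ℝ) :
    HasDerivAt (fun s : ℝ => fderiv ℝ F (y + s • v) v)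
      (iteratedFDeriv ℝ 2 F (y + t • v) ![v, v]) t := by
  have hd : Differentiable ℝ (fderiv ℝ F) :=
    (hF.fderiv_right (m := 1) (by norm_num)).differentiable one_ne_zero
  have h := (hd (y + t • v)).hasFDerivAt.comp_hasDerivAt t (hasDerivAt_add_smul y v t)
  simpa [iteratedFDeriv_two_apply] using h.clm_apply (hasDerivAt_const t v)

end Line

/-- The second derivative of `H` in the direction `(w, -α w)`, written in terms of its blocks. -/
theorem iteratedFDeriv_two_prod_sub_smul (d : ℕ)
    (H : EuclideanSpace ℝ (Fin d) × EuclideanSpace ℝ (Fin d) → ℝ)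
    (x p w : EuclideanSpace ℝ (Fin d)) (α : ℝ) :
    iteratedFDeriv ℝ 2 H (x, p) ![(w, -α • w), (w, -α • w)] =
      Qxx d H x p w - 2 * α * Qxp d H x p w + α ^ 2 * Qpp d H x p w := by
  have hw : (w, -α • w) = (w, 0) + (-α) • ((0 : EuclideanSpace ℝ (Fin d)), w) := by simp
  simp only [Qxx, Qxp, Qpp, iteratedFDeriv_two_apply, Matrix.cons_val_zero, Matrix.cons_val_one,
    hw, map_add, map_smul, add_apply, smul_apply,
    smul_eq_mul]
  ring

/-- A quadratic form that is nonnegative on unit vectors is nonnegative. -/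
theorem nonneg_of_forall_norm_eq_one {E : Type*} [NormedAddCommGroup E] [NormedSpace ℝ E]
    {q : E → ℝ} (hq : ∀ (c : ℝ) (w : E), q (c • w) = c ^ 2 * q w)
    (h : ∀ w : E, ‖w‖ = 1 → 0 ≤ q w) (w : E) : 0 ≤ q w := by
  rcases eq_or_ne w 0 with rfl | hw
  · simpa using (hq 0 0).ge
  · have hn : ‖w‖ ≠ 0 := norm_ne_zero_iff.mpr hw
    have hunit : ‖‖w‖⁻¹ • w‖ = 1 := by
      rw [norm_smul, norm_inv, norm_norm, inv_mul_cancel₀ hn]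
    have hmul := hq ‖w‖ (‖w‖⁻¹ • w)
    rw [smul_inv_smul₀ hn] at hmul
    rw [hmul]
    exact mul_nonneg (sq_nonneg _) (h _ hunit)

theorem iteratedFDeriv_two_smul_smul {E : Type*} [NormedAddCommGroup E] [NormedSpace ℝ E]
    (F : E → ℝ) (z v : E) (c : ℝ) :
    iteratedFDeriv ℝ 2 F z ![c • v, c • v] = c ^ 2 * iteratedFDeriv ℝ 2 F z ![v, v] := by
  simp only [iteratedFDeriv_two_apply, Matrix.cons_val_zero, Matrix.cons_val_one, map_smul,
    smul_apply, smul_eq_mul]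
  ring

/-- If `α ≥ 0` satisfies `λ_H - 2αλ₀ + α²M ≤ 0`, then `x ↦ H(x, p - αx)` is concave. -/
theorem concaveOn_sub_smul (d : ℕ)
    {H : EuclideanSpace ℝ (Fin d) × EuclideanSpace ℝ (Fin d) → ℝ} (hH : ContDiff ℝ 2 H)
    {M lam0 lamH α : ℝ}
    (hpp : ∀ x p w : EuclideanSpace ℝ (Fin d), ‖w‖ = 1 → Qpp d H x p w ≤ M)
    (hxp : ∀ x p w : EuclideanSpace ℝ (Fin d), ‖w‖ = 1 → lam0 ≤ Qxp d H x p w)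
    (hxx : ∀ x p w : EuclideanSpace ℝ (Fin d), ‖w‖ = 1 → Qxx d H x p w ≤ lamH)
    (hα : 0 ≤ α) (hquad : lamH - 2 * α * lam0 + α ^ 2 * M ≤ 0)
    (p : EuclideanSpace ℝ (Fin d)) :
    ConcaveOn ℝ univ (fun x : EuclideanSpace ℝ (Fin d) => H (x, p - α • x)) := by
  have hneg (z : EuclideanSpace ℝ (Fin d) × EuclideanSpace ℝ (Fin d))
      (w : EuclideanSpace ℝ (Fin d)) :
      0 ≤ -iteratedFDeriv ℝ 2 H z ![(w, -α • w), (w, -α • w)] := by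
    refine nonneg_of_forall_norm_eq_one
      (q := fun w => -iteratedFDeriv ℝ 2 H z ![(w, -α • w), (w, -α • w)])
      (fun c w => ?_) (fun w hw => ?_) w
    · have hc : (c • w, -α • c • w) = c • (w, -α • w) := by
        rw [Prod.smul_mk, smul_comm]
      simp only [hc, iteratedFDeriv_two_smul_smul]
      ring
    · obtain ⟨x, p⟩ := z
      have h1 := mul_le_mul_of_nonneg_left (hxp x p w hw) hα
      have h2 := mul_le_mul_of_nonneg_left (hpp x p w hw) (sq_nonneg α)
      simp only [iteratedFDeriv_two_prod_sub_smul]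
      linarith [hxx x p w hw]
  rw [← neg_convexOn_iff]
  refine convexOn_univ_of_forall_line fun x w => ?_
  have hline : (fun t : ℝ => (-fun x => H (x, p - α • x)) (x + t • w)) =
      fun t : ℝ => -H ((x, p - α • x) + t • (w, -α • w)) := by
    funext t
    have hpt : p - α • (x + t • w) = p - α • x + t • (-α • w) := by module
    simp only [Pi.neg_apply, Prod.smul_mk, Prod.mk_add_mk, hpt]
  rw [hline]
  exact convexOn_univ_of_hasDerivAt2_nonneg (fun t => (hH.hasDerivAt_line _ _ t).neg)
    (fun t => (hH.hasDerivAt_fderiv_line _ _ t).neg) (fun t => hneg _ _)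

/-- If the Hessian of `G` is bounded below by `-α`, then `G + (α/2)|·|²` is convex. -/
theorem convexOn_add_norm_sq {E : Type*} [NormedAddCommGroup E] [InnerProductSpace ℝ E]
    {G : E → ℝ} (hG : ContDiff ℝ 2 G) {α : ℝ}
    (h : ∀ x w : E, ‖w‖ = 1 → -α ≤ iteratedFDeriv ℝ 2 G x ![w, w]) :
    ConvexOn ℝ univ (fun x : E => G x + α / 2 * ‖x‖ ^ 2) := by
  refine convexOn_univ_of_forall_line fun x w => ?_
  have hnonneg (z : E) : 0 ≤ iteratedFDeriv ℝ 2 G z ![w, w] + α * ‖w‖ ^ 2 := by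
    refine nonneg_of_forall_norm_eq_one
      (q := fun w => iteratedFDeriv ℝ 2 G z ![w, w] + α * ‖w‖ ^ 2)
      (fun c w => ?_) (fun w hw => ?_) w
    · simp only [iteratedFDeriv_two_smul_smul, norm_smul, mul_pow, Real.norm_eq_abs, sq_abs]
      ring
    · simp only [hw]
      linarith [h z w hw]
  have hinner (t : ℝ) : HasDerivAt (fun s : ℝ => inner ℝ (x + s • w) w) (‖w‖ ^ 2) t := by
    simpa using (hasDerivAt_add_smul x w t).inner ℝ (hasDerivAt_const t w)
  refine convexOn_univ_of_hasDerivAt2_nonneg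
    (f' := fun t => fderiv ℝ G (x + t • w) w + α * inner ℝ (x + t • w) w)
    (fun t => ?_) (fun t => (hG.hasDerivAt_fderiv_line x w t).add ((hinner t).const_mul α))
    (fun t => hnonneg _)
  refine ((hG.hasDerivAt_line x w t).add
    ((hasDerivAt_add_smul x w t).norm_sq.const_mul (α / 2))).congr_deriv ?_
  ring

/-- (Convexification content of Theorem 3.3.) Under the eigenvalue bounds
`λ₀ ≤ wᵀ Re ∂_{xp}H w`, `wᵀ ∂_{xx}H w ≤ λ_H`, `λ_G ≤ wᵀ ∂_{xx}G w`,
`μ ≤ wᵀ ∂_{pp}H w ≤ M` with `0 < μ ≤ M`, and the conditions `λ₀² ≥ M λ_H`,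
`λ₀ + √(λ₀² - M λ_H) + M λ_G ≥ 0` and (`λ_H ≤ 0` or `λ₀ ≥ 0`), there is `α ∈ ℝ` such that
`H_α(x,p) = H(x, p - αx)` is concave in `x`, convex in `p`, and
`G_α(x) = G(x) + (α/2)|x|²` is convex. -/
theorem exists_convexifying_alpha
    (d : ℕ) (hd : 1 ≤ d)
    (H : EuclideanSpace ℝ (Fin d) × EuclideanSpace ℝ (Fin d) → ℝ)
    (hHsmooth : ContDiff ℝ 2 H)
    (hHconvp : ∀ x : EuclideanSpace ℝ (Fin d),
      ConvexOn ℝ Set.univ (fun p : EuclideanSpace ℝ (Fin d) => H (x, p)))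
    (μ M : ℝ) (hμ : 0 < μ) (hμM : μ ≤ M)
    (hQpp : ∀ (x p w : EuclideanSpace ℝ (Fin d)), ‖w‖ = 1 →
      μ ≤ Qpp d H x p w ∧ Qpp d H x p w ≤ M)
    (G : EuclideanSpace ℝ (Fin d) → ℝ) (hGsmooth : ContDiff ℝ 2 G)
    (lam0 lamH lamG : ℝ)
    (hxp : ∀ (x p w : EuclideanSpace ℝ (Fin d)), ‖w‖ = 1 → lam0 ≤ Qxp d H x p w)
    (hxx : ∀ (x p w : EuclideanSpace ℝ (Fin d)), ‖w‖ = 1 → Qxx d H x p w ≤ lamH)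
    (hG : ∀ (x w : EuclideanSpace ℝ (Fin d)), ‖w‖ = 1 → lamG ≤ QG d G x w)
    (hdisc : M * lamH ≤ lam0 ^ 2)
    (hsum : 0 ≤ lam0 + Real.sqrt (lam0 ^ 2 - M * lamH) + M * lamG)
    (hsign : lamH ≤ 0 ∨ 0 ≤ lam0) :
    ∃ α : ℝ,
      (∀ p : EuclideanSpace ℝ (Fin d),
        ConcaveOn ℝ Set.univ (fun x : EuclideanSpace ℝ (Fin d) => H (x, p - α • x))) ∧
      (∀ x : EuclideanSpace ℝ (Fin d),
        ConvexOn ℝ Set.univ (fun p : EuclideanSpace ℝ (Fin d) => H (x, p - α • x))) ∧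
      ConvexOn ℝ Set.univ
        (fun x : EuclideanSpace ℝ (Fin d) => G x + (α / 2) * ‖x‖ ^ 2) := by
  have hM : 0 < M := hμ.trans_le hμM
  set s := Real.sqrt (lam0 ^ 2 - M * lamH)
  have hs : s ^ 2 = lam0 ^ 2 - M * lamH := Real.sq_sqrt (sub_nonneg.mpr hdisc)
  have hs0 : 0 ≤ s := Real.sqrt_nonneg _
  have hnum : 0 ≤ lam0 + s := by
    rcases hsign with h | h
    · have habs : |lam0| ≤ s := Real.abs_le_sqrt (by nlinarith)
      linarith [neg_abs_le lam0]
    · exact add_nonneg h hs0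
  refine ⟨(lam0 + s) / M, concaveOn_sub_smul d hHsmooth (fun x p w hw => (hQpp x p w hw).2)
    hxp hxx (div_nonneg hnum hM.le) ?_, fun x => ?_,
    convexOn_add_norm_sq hGsmooth fun x w hw => ?_⟩
  · have hroot : lamH - 2 * ((lam0 + s) / M) * lam0 + ((lam0 + s) / M) ^ 2 * M =
        (s ^ 2 - (lam0 ^ 2 - M * lamH)) / M := by
      field_simp
      ring
    rw [hroot, hs, sub_self, zero_div]
  · simpa [Function.comp_def, sub_eq_add_neg] using
      (hHconvp x).translate_left (-(((lam0 + s) / M) • x))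
  · refine le_trans ?_ (hG x w hw)
    rw [neg_le_iff_add_nonneg, ← mul_nonneg_iff_of_pos_right hM, add_mul, div_mul_cancel₀ _ hM.ne']
    linarith
end

section
/- Let d ≥ 1 and let H : ℝ^d × ℝ^d → ℝ be C² with 0 < wᵀ ∂_{pp}H(x,p) w ≤ M for all (x,p) and all unit vectors w, for some M > 0. Suppose λ₀ ≥ 0 and λ_H ≥ 0 satisfy λ₀ ≤ wᵀ Re ∂_{xp}H(x,p) w and wᵀ ∂_{xx}H(x,p) w ≤ λ_H for all (x,p) and all unit vectors w, and suppose λ₀² ≥ M λ_H. Then for all (x,p) ∈ ℝ^d × ℝ^d and all unit vectors w ∈ ℝ^d, r₋(x,p,w) ≤ (λ₀ − √(λ₀² − M λ_H)) / M. -/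
open Set

/-- If the quadratic `a t² - 2 b t + c` is nonpositive at `t` and `a > 0`,
then its smaller root is at most `t`. -/
theorem smaller_root_le_of_quadratic_nonpos {a b c t : ℝ} (ha : 0 < a)
    (ht : a * t ^ 2 - 2 * b * t + c ≤ 0) :
    (b - Real.sqrt (b ^ 2 - a * c)) / a ≤ t := by
  rw [div_le_iff₀ ha]
  have h : b - a * t ≤ Real.sqrt (b ^ 2 - a * c) := by
    apply Real.le_sqrt_of_sq_le
    nlinarith [mul_nonpos_of_nonneg_of_nonpos ha.le ht]
  linarith

/-- The smaller root of `a t² - 2 b t + c` is monotone in `a` and `c` and antitone in `b`. -/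
theorem smaller_root_le_smaller_root {a b c M l h : ℝ} (ha : 0 < a) (haM : a ≤ M)
    (hl : 0 ≤ l) (hlb : l ≤ b) (hh : 0 ≤ h) (hch : c ≤ h) (hdisc : M * h ≤ l ^ 2) :
    (b - Real.sqrt (b ^ 2 - a * c)) / a ≤ (l - Real.sqrt (l ^ 2 - M * h)) / M := by
  have hM : 0 < M := ha.trans_le haM
  apply smaller_root_le_of_quadratic_nonpos ha
  set s := Real.sqrt (l ^ 2 - M * h) with hs
  have hsq : s ^ 2 = l ^ 2 - M * h := Real.sq_sqrt (by linarith)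
  have hsl : s ≤ l := Real.sqrt_le_iff.2 ⟨hl, by nlinarith [mul_nonneg hM.le hh]⟩
  set t := (l - s) / M with ht
  have ht0 : 0 ≤ t := div_nonneg (by linarith) hM.le
  have hroot : M * t ^ 2 - 2 * l * t + h = 0 := by
    rw [ht]
    field_simp
    linear_combination hsq
  nlinarith [mul_le_mul_of_nonneg_right haM (sq_nonneg t), mul_le_mul_of_nonneg_right hlb ht0]

/-- Under the bounds `0 < wᵀ∂_{pp}H w ≤ M`, `0 ≤ λ₀ ≤ wᵀ Re ∂_{xp}H w`,
`wᵀ∂_{xx}H w ≤ λ_H` with `λ_H ≥ 0` and `λ₀² ≥ M λ_H`, one has the upper bound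
`r₋(x,p,w) ≤ (λ₀ - √(λ₀² - M λ_H))/M` for all `(x,p)` and unit `w`. -/
theorem rminus_upper_bound
    (d : ℕ) (hd : 1 ≤ d)
    (H : EuclideanSpace ℝ (Fin d) × EuclideanSpace ℝ (Fin d) → ℝ)
    (hHsmooth : ContDiff ℝ 2 H)
    (M : ℝ) (hM : 0 < M)
    (hQpp : ∀ (x p w : EuclideanSpace ℝ (Fin d)), ‖w‖ = 1 →
      0 < Qpp d H x p w ∧ Qpp d H x p w ≤ M)
    (lam0 lamH : ℝ) (hlam0 : 0 ≤ lam0) (hlamH : 0 ≤ lamH)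
    (hxp : ∀ (x p w : EuclideanSpace ℝ (Fin d)), ‖w‖ = 1 → lam0 ≤ Qxp d H x p w)
    (hxx : ∀ (x p w : EuclideanSpace ℝ (Fin d)), ‖w‖ = 1 → Qxx d H x p w ≤ lamH)
    (hdisc : M * lamH ≤ lam0 ^ 2) :
    ∀ (x p w : EuclideanSpace ℝ (Fin d)), ‖w‖ = 1 →
      rminus d H x p w ≤ (lam0 - Real.sqrt (lam0 ^ 2 - M * lamH)) / M := by
  intro x p w hw
  obtain ⟨hpos, hle⟩ := hQpp x p w hw
  exact smaller_root_le_smaller_root hpos hle hlam0 (hxp x p w hw) hlamH (hxx x p w hw) hdisc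
end
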